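/- Let F = F̆(α_1,…,α_t) be a fence. The set Y = {χ̂_{s_i} : 1 ≤ i ≤ t−1} of order-ideal indicator functions of the shared elements is linearly independent in the vector space of functions J(F) → ℝ, and the ℝ-span of Y intersects the order ideal toggleability space I_T(F) only in the zero function. -/

import Mathlib

open scoped Classical

namespace Fence

/-- partial sums: `m α i = α 0 + ⋯ + α (i-1)` (the paper's `m_i`). -/
def m (α : ℕ → ℕ) (i : ℕ) : ℕ := ∑ k ∈ Finset.range i, α k

/-- the number `n` of elements of the fence `F̆(α)`. -/
def nn (t : ℕ) (α : ℕ → ℕ) : ℕ := m α t - 1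

/-- vertex type: index `0` is a dummy (used as sentinel for nonexistent elements);
the fence elements are the indices `1,…,nn t α`. -/
abbrev V (t : ℕ) (α : ℕ → ℕ) := Fin (nn t α + 1)

/-- the element `x_j` (1-based). -/
def xel (t : ℕ) (α : ℕ → ℕ) (j : ℕ) : V t α :=
  ⟨j % (nn t α + 1), Nat.mod_lt _ (Nat.succ_pos _)⟩

/-- `p` is an actual element of the fence (not the dummy `0`). -/
def Elem (t : ℕ) (α : ℕ → ℕ) (p : V t α) : Prop := 1 ≤ (p : ℕ)

/-- the conditions on `(t, α)` for `F̆(α)` to be a fence. -/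
def IsFence (t : ℕ) (α : ℕ → ℕ) : Prop :=
  2 ≤ t ∧ (∀ i < t, 1 ≤ α i) ∧ 2 ≤ α 0 ∧ 2 ≤ α (t - 1)

/-- the covering relation of the fence: `Cov t α a b` means `a ⋖ b`. -/
def Cov (t : ℕ) (α : ℕ → ℕ) (a b : V t α) : Prop :=
  ∃ i < t, ((i % 2 = 0 ∧ (b : ℕ) = (a : ℕ) + 1) ∨ (i % 2 = 1 ∧ (a : ℕ) = (b : ℕ) + 1)) ∧
    m α i ≤ min (a : ℕ) (b : ℕ) ∧ min (a : ℕ) (b : ℕ) < m α (i + 1) ∧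
    1 ≤ min (a : ℕ) (b : ℕ) ∧ max (a : ℕ) (b : ℕ) ≤ nn t α

/-- the order of the fence: reflexive–transitive closure of the covering relation. -/
def Le (t : ℕ) (α : ℕ → ℕ) : V t α → V t α → Prop := Relation.ReflTransGen (Cov t α)

/-- order ideals of the fence (as sets of actual elements, downward closed). -/
def IsIdeal (t : ℕ) (α : ℕ → ℕ) (I : Set (V t α)) : Prop :=
  (∀ p ∈ I, Elem t α p) ∧ ∀ a b : V t α, Le t α a b → b ∈ I → a ∈ I

/-- `J t α` is the set of order ideals of the fence. -/
abbrev J (t : ℕ) (α : ℕ → ℕ) := {I : Set (V t α) // IsIdeal t α I}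

/-- `p` is a maximal element of the set `I`. -/
def MaxIn (t : ℕ) (α : ℕ → ℕ) (I : Set (V t α)) (p : V t α) : Prop :=
  p ∈ I ∧ ∀ q ∈ I, Le t α p q → q = p

/-- `p` is a minimal element of the complement of `I` (among actual elements). -/
def MinOut (t : ℕ) (α : ℕ → ℕ) (I : Set (V t α)) (p : V t α) : Prop :=
  Elem t α p ∧ p ∉ I ∧ ∀ q : V t α, Elem t α q → q ∉ I → Le t α q p → q = p

/-- the order-ideal indicator function `χ̂_p`. -/
noncomputable def chiHat (t : ℕ) (α : ℕ → ℕ) (p : V t α) (I : J t α) : ℝ :=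
  if p ∈ I.1 then 1 else 0

/-- the antichain indicator function `χ_p`. -/
noncomputable def chi (t : ℕ) (α : ℕ → ℕ) (p : V t α) (I : J t α) : ℝ :=
  if MaxIn t α I.1 p then 1 else 0

/-- the toggleability statistic `T_p`. -/
noncomputable def Tg (t : ℕ) (α : ℕ → ℕ) (p : V t α) (I : J t α) : ℝ :=
  if MinOut t α I.1 p then 1 else if MaxIn t α I.1 p then -1 else 0

/-- the antichain toggleability statistic `T_A`. -/
noncomputable def TA (t : ℕ) (α : ℕ → ℕ) (A : Set (V t α)) (I : J t α) : ℝ :=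
  if ∀ p ∈ A, MinOut t α I.1 p then 1 else if ∀ p ∈ A, MaxIn t α I.1 p then -1 else 0

/-- `#[a,b]`: the number of elements `r` with `a ⊴ r ⊴ b`. -/
noncomputable def icard (t : ℕ) (α : ℕ → ℕ) (a b : V t α) : ℕ :=
  Set.ncard {r : V t α | Elem t α r ∧ Le t α a r ∧ Le t α r b}

/-- the span of the toggleability statistics `{T_p : p ∈ F}`. -/
noncomputable def ToggSpan (t : ℕ) (α : ℕ → ℕ) : Submodule ℝ (J t α → ℝ) :=
  Submodule.span ℝ {f | ∃ p : V t α, Elem t α p ∧ f = Tg t α p}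

/-- `f ≡ g`: `f - g` is an `ℝ`-linear combination of toggleability statistics. -/
def Equiv' (t : ℕ) (α : ℕ → ℕ) (f g : J t α → ℝ) : Prop := f - g ∈ ToggSpan t α

/-- statistics of the form `const + linear combination of toggleability statistics`. -/
noncomputable def ConstPlusTogg (t : ℕ) (α : ℕ → ℕ) : Submodule ℝ (J t α → ℝ) :=
  ToggSpan t α ⊔ Submodule.span ℝ {fun _ : J t α => (1 : ℝ)}

/-- the span of the antichain indicator functions `{χ_p : p ∈ F}`. -/
noncomputable def chiSpan (t : ℕ) (α : ℕ → ℕ) : Submodule ℝ (J t α → ℝ) :=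
  Submodule.span ℝ {f | ∃ p : V t α, Elem t α p ∧ f = chi t α p}

/-- the span of the order-ideal indicator functions `{χ̂_p : p ∈ F}`. -/
noncomputable def chiHatSpan (t : ℕ) (α : ℕ → ℕ) : Submodule ℝ (J t α → ℝ) :=
  Submodule.span ℝ {f | ∃ p : V t α, Elem t α p ∧ f = chiHat t α p}

/-- the antichain toggleability space `A_T(F)`. -/
noncomputable def AT (t : ℕ) (α : ℕ → ℕ) : Submodule ℝ (J t α → ℝ) :=
  chiSpan t α ⊓ ConstPlusTogg t α

/-- the order ideal toggleability space `I_T(F)`. -/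
noncomputable def IT (t : ℕ) (α : ℕ → ℕ) : Submodule ℝ (J t α → ℝ) :=
  chiHatSpan t α ⊓ ConstPlusTogg t α

/-- the shared element `s_i = x_{m_i}` (for `1 ≤ i ≤ t-1`); the sentinels `i = 0` and
`i = t` give the dummy vertex `0`, so statistics indexed by them vanish. -/
def sElx (t : ℕ) (α : ℕ → ℕ) (i : ℕ) : V t α := xel t α (m α i)

/-- 1-based index of the unshared element `s_{(i,j)}` (the `j`-th smallest unshared
element of the segment `S_i`, in the order of the fence). -/
def uEl (α : ℕ → ℕ) (i j : ℕ) : ℕ :=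
  if (i - 1) % 2 = 0 then m α (i - 1) + j else m α i - j

def uElx (t : ℕ) (α : ℕ → ℕ) (i j : ℕ) : V t α := xel t α (uEl α i j)

/-- 1-based index of the peak of segment `S_i` (sentinel `0` if it does not exist). -/
def peakN (t : ℕ) (α : ℕ → ℕ) (i : ℕ) : ℕ :=
  if i % 2 = 1 then (if i + 1 ≤ t then m α i else 0) else m α (i - 1)

/-- 1-based index of the valley of segment `S_i` (sentinel `0` if it does not exist). -/
def valleyN (t : ℕ) (α : ℕ → ℕ) (i : ℕ) : ℕ :=
  if i % 2 = 1 then (if 2 ≤ i then m α (i - 1) else 0) else (if i + 1 ≤ t then m α i else 0)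

def peakx (t : ℕ) (α : ℕ → ℕ) (i : ℕ) : V t α := xel t α (peakN t α i)
def valleyx (t : ℕ) (α : ℕ → ℕ) (i : ℕ) : V t α := xel t α (valleyN t α i)

/-- segment `S_i` has a peak. -/
def HasPeak (t i : ℕ) : Prop := i % 2 = 0 ∨ i + 1 ≤ t

/-- segment `S_i` has a valley. -/
def HasValley (t i : ℕ) : Prop := (i % 2 = 1 ∧ 2 ≤ i) ∨ (i % 2 = 0 ∧ i + 1 ≤ t)

/-- `p` is a shared element of the fence. -/
def IsSharedElem (t : ℕ) (α : ℕ → ℕ) (p : V t α) : Prop :=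
  ∃ i, 1 ≤ i ∧ i + 1 ≤ t ∧ p = sElx t α i

/-- `p` is a peak of the fence. -/
def IsPeakElem (t : ℕ) (α : ℕ → ℕ) (p : V t α) : Prop :=
  ∃ i, 1 ≤ i ∧ i + 1 ≤ t ∧ i % 2 = 1 ∧ p = sElx t α i

/-- span of the antichain indicators of the shared elements. -/
noncomputable def chiSharedSpan (t : ℕ) (α : ℕ → ℕ) : Submodule ℝ (J t α → ℝ) :=
  Submodule.span ℝ {f | ∃ i, 1 ≤ i ∧ i + 1 ≤ t ∧ f = chi t α (sElx t α i)}

/-- span of the order-ideal indicators of the shared elements. -/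
noncomputable def chiHatSharedSpan (t : ℕ) (α : ℕ → ℕ) : Submodule ℝ (J t α → ℝ) :=
  Submodule.span ℝ {f | ∃ i, 1 ≤ i ∧ i + 1 ≤ t ∧ f = chiHat t α (sElx t α i)}

theorem cov_elem {t : ℕ} {α : ℕ → ℕ} {a b : V t α} (h : Cov t α a b) :
    Elem t α a ∧ Elem t α b := by
  obtain ⟨i, hi, hd, h1, h2, h3, h4⟩ := h
  constructor <;> (simp only [Elem]; omega)

theorem le_elem {t : ℕ} {α : ℕ → ℕ} {a b : V t α} (h : Le t α a b) (hb : Elem t α b) :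
    Elem t α a := by
  induction h using Relation.ReflTransGen.head_induction_on with
  | refl => exact hb
  | head hc _ _ => exact (cov_elem hc).1

/-- rowmotion: `ρ(I)` is the order ideal generated by the minimal elements of the
complement of `I`. -/
noncomputable def rho (t : ℕ) (α : ℕ → ℕ) (I : J t α) : J t α :=
  ⟨{q | ∃ p : V t α, MinOut t α I.1 p ∧ Le t α q p}, by
    constructor
    · rintro q ⟨p, hp, hle⟩
      exact le_elem hle hp.1
    · rintro a b hab ⟨p, hp, hle⟩
      exact ⟨p, hp, Relation.ReflTransGen.trans hab hle⟩⟩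

/-- the (forward) orbit of `x` under `ρ`. -/
def orbit {X : Type*} (ρ : X → X) (x : X) : Set X := {y | ∃ k : ℕ, ρ^[k] x = y}

/-- `f` is `c`-mesic under `ρ`: the sum of `f` over each orbit is `c` times
the orbit size. -/
def IsMesic {X : Type*} (ρ : X → X) (f : X → ℝ) (c : ℝ) : Prop :=
  ∀ x : X, ∑ᶠ y ∈ orbit ρ x, f y = (orbit ρ x).ncard * c



/-- the edge `j → j+1` goes up. -/
def Up (t : ℕ) (α : ℕ → ℕ) (j : ℕ) : Prop :=
  ∃ i < t, i % 2 = 0 ∧ m α i ≤ j ∧ j < m α (i + 1)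

theorem m_succ (α : ℕ → ℕ) (i : ℕ) : m α (i + 1) = m α i + α i := by
  simp [m, Finset.sum_range_succ]

theorem m_mono (α : ℕ → ℕ) : Monotone (m α) :=
  monotone_nat_of_le_succ fun i => by rw [m_succ]; omega

theorem m_zero (α : ℕ → ℕ) : m α 0 = 0 := by simp [m]

theorem seg_unique {α : ℕ → ℕ} {i k j : ℕ} (h1 : m α i ≤ j) (h2 : j < m α (i + 1))
    (h3 : m α k ≤ j) (h4 : j < m α (k + 1)) : i = k := by
  rcases lt_trichotomy i k with h | h | h
  · have := m_mono α (show i + 1 ≤ k from h); omega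
  · exact h
  · have := m_mono α (show k + 1 ≤ i from h); omega

theorem seg_exists {α : ℕ → ℕ} {t j : ℕ} (h : j < m α t) :
    ∃ i < t, m α i ≤ j ∧ j < m α (i + 1) := by
  induction t with
  | zero => simp [m_zero] at h
  | succ k ih =>
    by_cases hk : j < m α k
    · obtain ⟨i, hi, h⟩ := ih hk
      exact ⟨i, by omega, h⟩
    · exact ⟨k, by omega, by omega, h⟩

theorem up_iff {t : ℕ} {α : ℕ → ℕ} {i j : ℕ} (hi : i < t) (h1 : m α i ≤ j)
    (h2 : j < m α (i + 1)) : Up t α j ↔ i % 2 = 0 := by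
  constructor
  · rintro ⟨k, hk, h3, h4, h5⟩
    rw [seg_unique h1 h2 h4 h5]; exact h3
  · intro h; exact ⟨i, hi, h, h1, h2⟩

theorem mt_pos {t : ℕ} {α : ℕ → ℕ} (hF : IsFence t α) : nn t α + 1 = m α t := by
  obtain ⟨h1, h2, h3, h4⟩ := hF
  have := m_mono α (show 1 ≤ t by omega)
  rw [m_succ, m_zero] at this
  unfold nn; omega

theorem cov_iff {t : ℕ} {α : ℕ → ℕ} (hF : IsFence t α) (a b : V t α) :
    Cov t α a b ↔ 1 ≤ (a : ℕ) ∧ 1 ≤ (b : ℕ) ∧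
      (((b : ℕ) = a + 1 ∧ Up t α a) ∨ ((a : ℕ) = b + 1 ∧ ¬ Up t α b)) := by
  have hn := mt_pos hF
  have ha := a.2
  have hb := b.2
  constructor
  · rintro ⟨i, hi, h | h, h1, h2, h3, h4⟩
    · have e : min (a : ℕ) b = a := by omega
      rw [e] at h1 h2
      refine ⟨by omega, by omega, Or.inl ⟨h.2, (up_iff hi h1 h2).2 h.1⟩⟩
    · have e : min (a : ℕ) b = b := by omega
      rw [e] at h1 h2
      refine ⟨by omega, by omega, Or.inr ⟨h.2, fun hu => ?_⟩⟩
      have := (up_iff hi h1 h2).1 hu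
      omega
  · rintro ⟨h1, h2, h | h⟩
    · have e : min (a : ℕ) b = a := by omega
      obtain ⟨i, hi, h3, h4, h5⟩ := h.2
      exact ⟨i, hi, Or.inl ⟨h3, h.1⟩, by omega, by omega, by omega, by omega⟩
    · have e : min (a : ℕ) b = b := by omega
      obtain ⟨i, hi, h4, h5⟩ := seg_exists (show (b : ℕ) < m α t by omega)
      have := mt (up_iff hi h4 h5).2 h.2
      exact ⟨i, hi, Or.inr ⟨by omega, h.1⟩, by omega, by omega, by omega, by omega⟩

theorem le_mono {t : ℕ} {α : ℕ → ℕ} (hF : IsFence t α) {a b : V t α} (h : Le t α a b) :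
    ((a : ℕ) ≤ b ∧ ∀ j : ℕ, a ≤ j → j < b → Up t α j) ∨
    ((b : ℕ) ≤ a ∧ ∀ j : ℕ, b ≤ j → j < a → ¬ Up t α j) := by
  induction h with
  | refl => left; exact ⟨le_rfl, fun j _ _ => by omega⟩
  | @tail b c _ hc ih =>
    rw [cov_iff hF] at hc
    obtain ⟨h1, h2, h | h⟩ := hc
    · rcases ih with ih | ih
      · left
        refine ⟨by omega, fun j hj1 hj2 => ?_⟩
        by_cases hj : j = b
        · rw [hj]; exact h.2
        · exact ih.2 j hj1 (by omega)
      · by_cases hab : (a : ℕ) = b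
        · left
          refine ⟨by omega, fun j hj1 hj2 => ?_⟩
          have : j = b := by omega
          rw [this]; exact h.2
        · exact absurd h.2 (ih.2 b le_rfl (by omega))
    · rcases ih with ih | ih
      · by_cases hab : (a : ℕ) = b
        · right
          refine ⟨by omega, fun j hj1 hj2 => ?_⟩
          have : j = c := by omega
          rw [this]; exact h.2
        · exact absurd (ih.2 c (by omega) (by omega)) h.2
      · right
        refine ⟨by omega, fun j hj1 hj2 => ?_⟩
        by_cases hj : j = c
        · rw [hj]; exact h.2
        · exact ih.2 j (by omega) hj2

theorem le_antis {t : ℕ} {α : ℕ → ℕ} (hF : IsFence t α) {a b : V t α} (h : Le t α a b)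
    (h' : Le t α b a) : a = b := by
  have h1 := le_mono hF h
  have h2 := le_mono hF h'
  apply Fin.ext
  rcases lt_trichotomy (a : ℕ) b with h | h | h
  · have u := (h1.resolve_right (by omega)).2 a le_rfl h
    exact absurd u ((h2.resolve_left (by omega)).2 a le_rfl h)
  · exact h
  · have u := (h2.resolve_right (by omega)).2 b le_rfl h
    exact absurd u ((h1.resolve_left (by omega)).2 b le_rfl h)

/-- ideal built from an antichain `A` and a subset `B` of it. -/
def mkI (t : ℕ) (α : ℕ → ℕ) (hF : IsFence t α) (A B : Set (V t α)) (hBA : B ⊆ A)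
    (hA : ∀ a ∈ A, Elem t α a) (hanti : ∀ a ∈ A, ∀ b ∈ A, Le t α a b → a = b) : J t α :=
  ⟨{x | x ∈ B ∨ (x ∉ A ∧ ∃ a ∈ A, Le t α x a)}, by
    constructor
    · rintro p (hp | ⟨_, a, ha, hl⟩)
      · exact hA p (hBA hp)
      · exact le_elem hl (hA a ha)
    · rintro y x hl (hx | ⟨hx, a, ha, hla⟩)
      · by_cases hy : y ∈ A
        · left; rw [hanti y hy x (hBA hx) hl]; exact hx
        · right; exact ⟨hy, x, hBA hx, hl⟩
      · right
        refine ⟨fun hy => hx ?_, a, ha, hl.trans hla⟩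
        have e := hanti y hy a ha (hl.trans hla)
        subst e
        rw [le_antis hF hla hl]; exact hy⟩

/-- extended membership predicate on natural positions. -/
def InI (t : ℕ) (α : ℕ → ℕ) (I : J t α) (j : ℕ) : Prop :=
  j = 0 ∨ (1 ≤ j ∧ j ≤ nn t α ∧ xel t α j ∈ I.1) ∨ (nn t α < j ∧ ¬ Up t α (nn t α))

/-- its real-valued indicator. -/
noncomputable def X (t : ℕ) (α : ℕ → ℕ) (I : J t α) (j : ℕ) : ℝ :=
  if InI t α I j then 1 else 0

theorem xel_val {t : ℕ} {α : ℕ → ℕ} {j : ℕ} (h : j ≤ nn t α) : (xel t α j : ℕ) = j :=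
  Nat.mod_eq_of_lt (by omega)

theorem xel_self {t : ℕ} {α : ℕ → ℕ} (p : V t α) : xel t α p = p :=
  Fin.ext (xel_val (by have := p.2; omega))

theorem inI_mid {t : ℕ} {α : ℕ → ℕ} {I : J t α} {j : ℕ} (h1 : 1 ≤ j) (h2 : j ≤ nn t α) :
    InI t α I j ↔ xel t α j ∈ I.1 := by
  unfold InI
  constructor
  · rintro (h | h | h)
    · omega
    · exact h.2.2
    · omega
  · intro h; exact Or.inr (Or.inl ⟨h1, h2, h⟩)

theorem inI_zero {t : ℕ} {α : ℕ → ℕ} {I : J t α} : InI t α I 0 := Or.inl rfl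

theorem inI_top {t : ℕ} {α : ℕ → ℕ} {I : J t α} :
    InI t α I (nn t α + 1) ↔ ¬ Up t α (nn t α) := by
  unfold InI
  constructor
  · rintro (h | h | h)
    · omega
    · omega
    · exact h.2
  · intro h; exact Or.inr (Or.inr ⟨by omega, h⟩)

theorem up_zero {t : ℕ} {α : ℕ → ℕ} (hF : IsFence t α) : Up t α 0 := by
  refine ⟨0, by have := hF.1; omega, rfl, by simp [m_zero], ?_⟩
  rw [m_succ, m_zero]; have := hF.2.2.1; omega

theorem inI_down {t : ℕ} {α : ℕ → ℕ} (hF : IsFence t α) (I : J t α) {j : ℕ} (hj : j ≤ nn t α) :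
    (Up t α j → InI t α I (j + 1) → InI t α I j) ∧
    (¬ Up t α j → InI t α I j → InI t α I (j + 1)) := by
  by_cases h0 : j = 0
  · subst h0
    exact ⟨fun _ _ => inI_zero, fun h => absurd (up_zero hF) h⟩
  by_cases hn : j = nn t α
  · subst hn
    rw [inI_top]
    exact ⟨fun h h' => absurd h h', fun h _ => h⟩
  rw [inI_mid (by omega) hj, inI_mid (by omega) (by omega)]
  have e1 := xel_val (t := t) (α := α) hj
  have e2 := xel_val (t := t) (α := α) (show j + 1 ≤ nn t α by omega)
  constructor
  · intro hu h
    refine I.2.2 _ _ (Relation.ReflTransGen.single ((cov_iff hF _ _).2 ?_)) h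
    rw [e1, e2]
    exact ⟨by omega, by omega, Or.inl ⟨rfl, hu⟩⟩
  · intro hu h
    refine I.2.2 _ _ (Relation.ReflTransGen.single ((cov_iff hF _ _).2 ?_)) h
    rw [e1, e2]
    exact ⟨by omega, by omega, Or.inr ⟨rfl, hu⟩⟩

theorem maxIn_iff {t : ℕ} {α : ℕ → ℕ} (hF : IsFence t α) (I : J t α) {p : ℕ} (h1 : 1 ≤ p)
    (h2 : p ≤ nn t α) : MaxIn t α I.1 (xel t α p) ↔
      InI t α I p ∧ (¬ Up t α (p - 1) → ¬ InI t α I (p - 1)) ∧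
        (Up t α p → ¬ InI t α I (p + 1)) := by
  have e1 := xel_val (t := t) (α := α) h2
  rw [inI_mid h1 h2]
  constructor
  · rintro ⟨h, hm⟩
    refine ⟨h, fun hu hi => ?_, fun hu hi => ?_⟩
    · have hp : p - 1 ≠ 0 := fun h => hu (h ▸ up_zero hF)
      rw [inI_mid (by omega) (by omega)] at hi
      have e2 := xel_val (t := t) (α := α) (show p - 1 ≤ nn t α by omega)
      have := hm _ hi (Relation.ReflTransGen.single ((cov_iff hF _ _).2
        (by rw [e1, e2]; exact ⟨by omega, by omega, Or.inr ⟨by omega, hu⟩⟩)))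
      have := congrArg Fin.val this
      omega
    · by_cases hp : p = nn t α
      · subst hp; exact inI_top.1 hi hu
      rw [inI_mid (by omega) (by omega)] at hi
      have e2 := xel_val (t := t) (α := α) (show p + 1 ≤ nn t α by omega)
      have := hm _ hi (Relation.ReflTransGen.single ((cov_iff hF _ _).2
        (by rw [e1, e2]; exact ⟨by omega, by omega, Or.inl ⟨by omega, hu⟩⟩)))
      have := congrArg Fin.val this
      omega
  · rintro ⟨h, ha, hb⟩
    refine ⟨h, fun q hq hl => ?_⟩
    rcases Relation.ReflTransGen.cases_head hl with e | ⟨c, hc, hcq⟩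
    · exact e.symm
    · exfalso
      have hcI := I.2.2 _ _ hcq hq
      have hcn := c.2
      rw [cov_iff hF, e1] at hc
      obtain ⟨_, hc1, hc | hc⟩ := hc
      · refine hb hc.2 ((inI_mid (by omega) (by omega)).2 ?_)
        rw [← hc.1, xel_self]; exact hcI
      · have e : p - 1 = c := by omega
        rw [e] at ha
        refine ha hc.2 ((inI_mid (by omega) (by omega)).2 ?_)
        rw [xel_self]; exact hcI

theorem minOut_iff {t : ℕ} {α : ℕ → ℕ} (hF : IsFence t α) (I : J t α) {p : ℕ} (h1 : 1 ≤ p)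
    (h2 : p ≤ nn t α) : MinOut t α I.1 (xel t α p) ↔
      ¬ InI t α I p ∧ (Up t α (p - 1) → InI t α I (p - 1)) ∧
        (¬ Up t α p → InI t α I (p + 1)) := by
  have e1 := xel_val (t := t) (α := α) h2
  rw [inI_mid h1 h2]
  constructor
  · rintro ⟨_, h, hm⟩
    refine ⟨h, fun hu => ?_, fun hu => ?_⟩
    · by_contra hi
      have hp : p - 1 ≠ 0 := fun h => hi (h ▸ inI_zero)
      rw [inI_mid (by omega) (by omega)] at hi
      have e2 := xel_val (t := t) (α := α) (show p - 1 ≤ nn t α by omega)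
      have := hm _ (by unfold Elem; omega) hi (Relation.ReflTransGen.single ((cov_iff hF _ _).2
        (by rw [e1, e2]; exact ⟨by omega, by omega, Or.inl ⟨by omega, hu⟩⟩)))
      have := congrArg Fin.val this
      omega
    · by_contra hi
      by_cases hp : p = nn t α
      · subst hp; exact hi (inI_top.2 hu)
      rw [inI_mid (by omega) (by omega)] at hi
      have e2 := xel_val (t := t) (α := α) (show p + 1 ≤ nn t α by omega)
      have := hm _ (by unfold Elem; omega) hi (Relation.ReflTransGen.single ((cov_iff hF _ _).2
        (by rw [e1, e2]; exact ⟨by omega, by omega, Or.inr ⟨by omega, hu⟩⟩)))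
      have := congrArg Fin.val this
      omega
  · rintro ⟨h, ha, hb⟩
    refine ⟨by unfold Elem; omega, h, fun q hqe hq hl => ?_⟩
    rcases Relation.ReflTransGen.cases_tail hl with e | ⟨c, hqc, hc⟩
    · exact e.symm
    · exfalso
      have hcI : c ∉ I.1 := fun hc' => hq (I.2.2 _ _ hqc hc')
      have hcn := c.2
      rw [cov_iff hF, e1] at hc
      obtain ⟨hc1, _, hc | hc⟩ := hc
      · have e : p - 1 = c := by omega
        rw [e] at ha
        have := (inI_mid (by omega) (by omega)).1 (ha hc.2)
        rw [xel_self] at this; exact hcI this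
      · have := (inI_mid (by omega) (by omega)).1 (hb hc.2)
        rw [← hc.1, xel_self] at this; exact hcI this

/-- polynomial formula for the toggleability statistics. -/
theorem Tg_eq {t : ℕ} {α : ℕ → ℕ} (hF : IsFence t α) (I : J t α) {p : ℕ} (h1 : 1 ≤ p)
    (h2 : p ≤ nn t α) :
    ((Up t α (p - 1) ↔ Up t α p) →
      Tg t α (xel t α p) I = X t α I (p - 1) - 2 * X t α I p + X t α I (p + 1)) ∧
    (Up t α (p - 1) → ¬ Up t α p →
      Tg t α (xel t α p) I = X t α I (p - 1) * X t α I (p + 1) - 2 * X t α I p) ∧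
    (¬ Up t α (p - 1) → Up t α p →
      Tg t α (xel t α p) I = 1 - 2 * X t α I p + X t α I (p - 1) + X t α I (p + 1)
        - X t α I (p - 1) * X t α I (p + 1)) := by
  have d1 := inI_down hF I (show p - 1 ≤ nn t α by omega)
  rw [show p - 1 + 1 = p by omega] at d1
  have d2 := inI_down hF I h2
  unfold Tg X
  rw [maxIn_iff hF I h1 h2, minOut_iff hF I h1 h2]
  by_cases u1 : Up t α (p - 1) <;> by_cases u2 : Up t α p <;>
  by_cases i1 : InI t α I (p - 1) <;> by_cases i2 : InI t α I p <;>
  by_cases i3 : InI t α I (p + 1) <;> simp [u1, u2, i1, i2, i3] at d1 d2 ⊢ <;> norm_num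

theorem shared_props {t : ℕ} {α : ℕ → ℕ} (hF : IsFence t α) {i : ℕ} (h1 : 1 ≤ i) (h2 : i < t) :
    2 ≤ m α i ∧ m α i + 1 ≤ nn t α ∧ ¬ (Up t α (m α i - 1) ↔ Up t α (m α i)) := by
  have hn := mt_pos hF
  obtain ⟨ht, hpos, ha, hb⟩ := hF
  have e1 := m_mono α h1
  rw [m_succ, m_zero] at e1
  have e2 := m_mono α (show i ≤ t - 1 by omega)
  have e3 := m_succ α (t - 1)
  rw [show t - 1 + 1 = t by omega] at e3
  have e4 := m_succ α (i - 1)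
  rw [show i - 1 + 1 = i by omega] at e4
  have e5 := m_succ α i
  have p1 := hpos i h2
  have p2 := hpos (i - 1) (by omega)
  refine ⟨by omega, by omega, ?_⟩
  rw [up_iff h2 le_rfl (by omega), up_iff (i := i - 1) (by omega) (by omega)
    (by rw [show i - 1 + 1 = i by omega]; omega)]
  omega

theorem unshared_props {t : ℕ} {α : ℕ → ℕ} (hF : IsFence t α) {p : ℕ} (h1 : 1 ≤ p)
    (h2 : p ≤ nn t α) (h : ∀ i, 1 ≤ i → i < t → p ≠ m α i) :
    (Up t α (p - 1) ↔ Up t α p) := by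
  have hn := mt_pos hF
  obtain ⟨i, hi, h3, h4⟩ := seg_exists (show p < m α t by omega)
  have hlt : m α i ≠ p := by
    intro e
    rcases Nat.eq_zero_or_pos i with h0 | h0
    · subst h0; rw [m_zero] at e; omega
    · exact h i h0 hi e.symm
  rw [up_iff hi h3 h4, up_iff hi (j := p - 1) (by omega) (by omega)]

theorem m_inj {t : ℕ} {α : ℕ → ℕ} (hF : IsFence t α) {i k : ℕ} (h1 : i < t) (h2 : k < t)
    (h : m α i = m α k) : i = k := by
  have e1 := m_succ α i
  have e2 := m_succ α k
  have p1 := hF.2.1 i h1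
  have p2 := hF.2.1 k h2
  exact seg_unique (j := m α i) le_rfl (by omega) (by omega) (by omega)

/-- one-element difference -/
theorem exists_pair {t : ℕ} {α : ℕ → ℕ} (hF : IsFence t α) {p : ℕ} (h1 : 1 ≤ p)
    (h2 : p ≤ nn t α) : ∃ I K : J t α, ∀ j, X t α I j - X t α K j = if j = p then 1 else 0 := by
  have e := xel_val (t := t) (α := α) h2
  have hA : ∀ a ∈ ({xel t α p} : Set (V t α)), Elem t α a := by
    rintro a rfl; unfold Elem; omega
  have hanti : ∀ a ∈ ({xel t α p} : Set (V t α)), ∀ b ∈ ({xel t α p} : Set (V t α)),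
      Le t α a b → a = b := by
    rintro a rfl b rfl _; rfl
  refine ⟨mkI t α hF {xel t α p} {xel t α p} subset_rfl hA hanti,
    mkI t α hF {xel t α p} ∅ (Set.empty_subset _) hA hanti, fun j => ?_⟩
  by_cases hj : 1 ≤ j ∧ j ≤ nn t α
  · unfold X
    rw [inI_mid hj.1 hj.2, inI_mid hj.1 hj.2]
    have ej := xel_val (t := t) (α := α) hj.2
    by_cases hjp : j = p
    · subst hjp
      simp [mkI]
    · have : xel t α j ≠ xel t α p := fun h => hjp (by rw [← ej, h, e])
      simp [mkI, this, hjp]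
  · have hjp : j ≠ p := by omega
    unfold X InI
    have : ¬ (1 ≤ j ∧ j ≤ nn t α ∧ xel t α j ∈ (mkI t α hF {xel t α p} {xel t α p} subset_rfl hA hanti).1) := by tauto
    have : ¬ (1 ≤ j ∧ j ≤ nn t α ∧ xel t α j ∈ (mkI t α hF {xel t α p} ∅ (Set.empty_subset _) hA hanti).1) := by tauto
    simp [*]

/-- two-element mixed difference -/
theorem exists_quad {t : ℕ} {α : ℕ → ℕ} (hF : IsFence t α) {s : ℕ} (h1 : 2 ≤ s)
    (h2 : s + 1 ≤ nn t α) (hs : ¬ (Up t α (s - 1) ↔ Up t α s)) :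
    ∃ x : ℕ → ℝ, ∃ I : Bool → Bool → J t α, ∀ b c j, X t α (I b c) j =
      if j = s - 1 then (if b then 1 else 0) else if j = s + 1 then (if c then 1 else 0)
      else x j := by
  have e1 := xel_val (t := t) (α := α) (show s - 1 ≤ nn t α by omega)
  have e2 := xel_val (t := t) (α := α) h2
  let A : Set (V t α) := {a | (a : ℕ) = s - 1 ∨ (a : ℕ) = s + 1}
  let B : Bool → Bool → Set (V t α) := fun b c =>
    {a | ((a : ℕ) = s - 1 ∧ b = true) ∨ ((a : ℕ) = s + 1 ∧ c = true)}
  have hBA : ∀ b c, B b c ⊆ A := by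
    rintro b c a (h | h)
    · exact Or.inl h.1
    · exact Or.inr h.1
  have hA : ∀ a ∈ A, Elem t α a := by
    rintro a (h | h) <;> (unfold Elem; omega)
  have hanti : ∀ a ∈ A, ∀ b ∈ A, Le t α a b → a = b := by
    intro a ha b hb hl
    have hm := le_mono hF hl
    apply Fin.ext
    rcases ha with ha | ha <;> rcases hb with hb | hb
    · omega
    · have := (hm.resolve_right (by omega)).2
      exact absurd (iff_of_true (this (s - 1) (by omega) (by omega))
        (this s (by omega) (by omega))) hs
    · have := (hm.resolve_left (by omega)).2
      exact absurd (iff_of_false (this (s - 1) (by omega) (by omega))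
        (this s (by omega) (by omega))) hs
    · omega
  refine ⟨X t α (mkI t α hF A (B false false) (hBA _ _) hA hanti),
    fun b c => mkI t α hF A (B b c) (hBA _ _) hA hanti, fun b c j => ?_⟩
  by_cases hj : 1 ≤ j ∧ j ≤ nn t α
  · unfold X
    rw [inI_mid hj.1 hj.2, inI_mid hj.1 hj.2]
    have ej := xel_val (t := t) (α := α) hj.2
    have hk : s + 1 ≠ s - 1 := by omega
    by_cases hja : j = s - 1
    · simp [mkI, A, B, ej, hja, hk.symm, e1]
    · by_cases hjb : j = s + 1
      · simp [mkI, A, B, ej, hjb, hk, e2]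
      · simp [mkI, A, B, ej, hja, hjb]
  · rw [if_neg (by omega), if_neg (by omega)]
    unfold X InI
    have (b c : Bool) : ¬ (1 ≤ j ∧ j ≤ nn t α ∧ xel t α j ∈ (mkI t α hF A (B b c) (hBA _ _) hA hanti).1) := by tauto
    simp [this]

theorem max_principle {n : ℕ} {a : ℕ → ℝ} (h0 : a 0 ≤ 0)
    (h : ∀ p, 1 ≤ p → p ≤ n → a p ≤ 0 ∨ 2 * a p ≤ a (p - 1) + a (p + 1))
    (hn : a (n + 1) ≤ 0) : ∀ p ≤ n, a p ≤ 0 := by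
  by_contra! hc
  obtain ⟨p, hp, hpos⟩ := hc
  -- once positive with an ascent, it keeps ascending
  have hex : ∃ p, p ≤ n ∧ 0 < a p := ⟨p, hp, hpos⟩
  obtain ⟨hq1, hq2⟩ := Nat.find_spec hex
  have hmin := fun k => Nat.find_min hex (m := k)
  set q := Nat.find hex
  have hq0 : 1 ≤ q := by
    by_contra h
    have : q = 0 := by omega
    rw [this] at hq2; linarith
  have hprev : a (q - 1) ≤ 0 := by
    have := hmin (q - 1) (by omega)
    by_contra hh
    exact this ⟨by omega, by linarith⟩
  have key : ∀ k, q + k ≤ n → 0 < a (q + k) ∧ a (q + k) < a (q + k + 1) := by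
    intro k
    induction k with
    | zero =>
      intro _
      refine ⟨hq2, ?_⟩
      rcases h q hq0 hq1 with h | h
      · linarith
      · simp only [add_zero]; linarith
    | succ k ih =>
      intro hk
      obtain ⟨i1, i2⟩ := ih (by omega)
      have hp' : 0 < a (q + (k + 1)) := by rw [← add_assoc]; linarith
      refine ⟨hp', ?_⟩
      rcases h (q + (k + 1)) (by omega) hk with h | h
      · linarith
      · rw [show q + (k + 1) - 1 = q + k by omega] at h
        rw [← add_assoc] at h ⊢
        linarith
  have := key (n - q) (by omega)
  rw [show q + (n - q) = n by omega] at this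
  linarith

theorem chiHat_s {t : ℕ} {α : ℕ → ℕ} (hF : IsFence t α) {i : ℕ} (h1 : 1 ≤ i) (h2 : i < t)
    (I : J t α) : chiHat t α (sElx t α i) I = X t α I (m α i) := by
  have h := shared_props hF h1 h2
  unfold chiHat X sElx
  rw [inI_mid (by omega) (by omega)]

/-- a combination of shared indicators that is constant has zero coefficients. -/
theorem coeff_zero {t : ℕ} {α : ℕ → ℕ} (hF : IsFence t α) (c : Fin (t - 1) → ℝ) (d : ℝ)
    (h : ∀ I : J t α, ∑ i, c i * X t α I (m α (i + 1)) = d) : ∀ i, c i = 0 := by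
  intro i
  have hi := i.2
  have hp := shared_props hF (show 1 ≤ (i : ℕ) + 1 by omega) (by omega)
  obtain ⟨I, K, hIK⟩ := exists_pair hF (show 1 ≤ m α (i + 1) by omega) (by omega)
  have h1 := h I
  have h2 := h K
  have h3 : ∑ k, c k * (X t α I (m α (k + 1)) - X t α K (m α (k + 1))) = 0 := by
    simp only [mul_sub, Finset.sum_sub_distrib]; linarith
  rw [Finset.sum_eq_single i] at h3
  · rw [hIK] at h3; simpa using h3
  · intro k _ hk
    have hk2 := k.2
    rw [hIK, if_neg, mul_zero]
    intro e
    have := m_inj hF (by omega) (by omega) e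
    exact hk (Fin.ext (by omega))
  · simp

theorem main_aux {t : ℕ} {α : ℕ → ℕ} (hF : IsFence t α) (c : Fin (t - 1) → ℝ) (d : ℝ)
    (a : ℕ → ℝ) (ha0 : a 0 = 0) (han : a (nn t α + 1) = 0)
    (h : ∀ I : J t α, ∑ i, c i * X t α I (m α (i + 1)) =
      d + ∑ p ∈ Finset.Icc 1 (nn t α), a p * Tg t α (xel t α p) I) : ∀ i, c i = 0 := by
  -- step 1: shared coefficients vanish
  have s1 : ∀ i, 1 ≤ i → i < t → a (m α i) = 0 := by
    intro i hi1 hi2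
    obtain ⟨h1, h2, h3⟩ := shared_props hF hi1 hi2
    set s := m α i with hs
    obtain ⟨x, I, hI⟩ := exists_quad hF h1 h2 h3
    have hX : ∀ j, X t α (I true true) j - X t α (I true false) j - X t α (I false true) j
        + X t α (I false false) j = 0 := by
      intro j; simp only [hI]; split_ifs <;> simp_all
    have hXX : ∀ p, 1 ≤ p → p ≠ s → X t α (I true true) (p - 1) * X t α (I true true) (p + 1)
        - X t α (I true false) (p - 1) * X t α (I true false) (p + 1)
        - X t α (I false true) (p - 1) * X t α (I false true) (p + 1)
        + X t α (I false false) (p - 1) * X t α (I false false) (p + 1) = 0 := by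
      intro p hp1 hp
      simp only [hI]
      by_cases c1 : p - 1 = s - 1
      · omega
      · by_cases c2 : p + 1 = s + 1
        · omega
        · by_cases c3 : p - 1 = s + 1
          · have c4 : ¬ p + 1 = s - 1 := by omega
            simp [c1, c2, c3, c4, show s + 1 ≠ s - 1 by omega]
          · by_cases c4 : p + 1 = s - 1
            · simp [c1, c3, c4]
            · simp [c1, c2, c3, c4]
    have hXs : X t α (I true true) (s - 1) * X t α (I true true) (s + 1)
        - X t α (I true false) (s - 1) * X t α (I true false) (s + 1)
        - X t α (I false true) (s - 1) * X t α (I false true) (s + 1)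
        + X t α (I false false) (s - 1) * X t α (I false false) (s + 1) = 1 := by
      simp only [hI]
      simp [show s + 1 ≠ s - 1 by omega]
    have hT : ∑ p ∈ Finset.Icc 1 (nn t α), a p * (Tg t α (xel t α p) (I true true)
        - Tg t α (xel t α p) (I true false) - Tg t α (xel t α p) (I false true)
        + Tg t α (xel t α p) (I false false)) = 0 := by
      have hL : ∑ i, c i * (X t α (I true true) (m α (i + 1))
        - X t α (I true false) (m α (i + 1)) - X t α (I false true) (m α (i + 1))
        + X t α (I false false) (m α (i + 1))) = 0 := by
        simp only [hX, mul_zero, Finset.sum_const_zero]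
      simp only [mul_sub, mul_add, Finset.sum_sub_distrib, Finset.sum_add_distrib, h] at hL ⊢
      linarith
    rw [Finset.sum_eq_single s] at hT
    · have g := fun b c => Tg_eq hF (I b c) (show 1 ≤ s by omega) (show s ≤ nn t α by omega)
      have k1 := hX s
      have k2 := hX (s - 1)
      have k3 := hX (s + 1)
      rcases mul_eq_zero.1 hT with h | h
      · exact h
      · exfalso
        by_cases u : Up t α (s - 1)
        · have u2 : ¬ Up t α s := by tauto
          have g' := fun b c => (g b c).2.1 u u2
          simp only [g'] at h
          linarith
        · have u2 : Up t α s := by tauto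
          have g' := fun b c => (g b c).2.2 u u2
          simp only [g'] at h
          linarith
    · intro p hp hps
      rw [Finset.mem_Icc] at hp
      have g := fun b c => Tg_eq hF (I b c) hp.1 hp.2
      have k1 := hX p
      have k2 := hX (p - 1)
      have k3 := hX (p + 1)
      have k4 := hXX p hp.1 hps
      refine mul_eq_zero_of_right _ ?_
      by_cases u : Up t α (p - 1) <;> by_cases u2 : Up t α p
      · have g' := fun b c => (g b c).1 (iff_of_true u u2)
        simp only [g']; linarith
      · have g' := fun b c => (g b c).2.1 u u2
        simp only [g']; linarith
      · have g' := fun b c => (g b c).2.2 u u2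
        simp only [g']; linarith
      · have g' := fun b c => (g b c).1 (iff_of_false u u2)
        simp only [g']; linarith
    · intro hns
      exact absurd (Finset.mem_Icc.2 ⟨by omega, by omega⟩) hns
  -- the statistic is now linear
  have h' : ∀ I : J t α, ∑ i, c i * X t α I (m α (i + 1)) =
      d + ∑ p ∈ Finset.Icc 1 (nn t α),
        a p * (X t α I (p - 1) - 2 * X t α I p + X t α I (p + 1)) := by
    intro I
    rw [h I]
    congr 1
    refine Finset.sum_congr rfl fun p hp => ?_
    rw [Finset.mem_Icc] at hp
    by_cases hsh : ∃ i, 1 ≤ i ∧ i < t ∧ p = m α i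
    · obtain ⟨i, h1, h2, rfl⟩ := hsh
      rw [s1 i h1 h2]; simp
    · rw [(Tg_eq hF I hp.1 hp.2).1 (unshared_props hF hp.1 hp.2
        (fun i h1 h2 h3 => hsh ⟨i, h1, h2, h3⟩))]
  -- step 2
  have s2 : ∀ p, 1 ≤ p → p ≤ nn t α → a p = 0 ∨ 2 * a p = a (p - 1) + a (p + 1) := by
    intro p hp1 hp2
    by_cases hsh : ∃ i, 1 ≤ i ∧ i < t ∧ p = m α i
    · obtain ⟨i, h1, h2, rfl⟩ := hsh
      exact Or.inl (s1 i h1 h2)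
    right
    obtain ⟨I, K, hIK⟩ := exists_pair hF hp1 hp2
    have hL : ∑ i, c i * (X t α I (m α (i + 1)) - X t α K (m α (i + 1))) = 0 := by
      refine Finset.sum_eq_zero fun i _ => ?_
      have hi := i.2
      rw [hIK, if_neg, mul_zero]
      intro e
      exact hsh ⟨i + 1, by omega, by omega, e.symm⟩
    have hR : ∑ q ∈ Finset.Icc 1 (nn t α), a q * ((X t α I (q - 1) - X t α K (q - 1))
        - 2 * (X t α I q - X t α K q) + (X t α I (q + 1) - X t α K (q + 1))) = 0 := by
      have e1 := h' I
      have e2 := h' K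
      simp only [mul_sub, Finset.sum_sub_distrib, e1, e2] at hL
      simp only [mul_sub, mul_add, Finset.sum_sub_distrib, Finset.sum_add_distrib] at hL ⊢
      linarith
    simp only [hIK, mul_add, mul_sub, Finset.sum_add_distrib, Finset.sum_sub_distrib] at hR
    have r1 : ∑ q ∈ Finset.Icc 1 (nn t α), a q * (if q - 1 = p then (1 : ℝ) else 0)
        = a (p + 1) := by
      rw [Finset.sum_eq_single (p + 1)]
      · simp
      · intro q hq hne
        rw [if_neg (by omega), mul_zero]
      · intro hn
        rw [Finset.mem_Icc] at hn
        have : p + 1 = nn t α + 1 := by omega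
        rw [this, han, zero_mul]
    have r2 : ∑ q ∈ Finset.Icc 1 (nn t α), a q * (2 * (if q = p then (1 : ℝ) else 0))
        = 2 * a p := by
      rw [Finset.sum_eq_single p]
      · simp [mul_comm]
      · intro q hq hne
        rw [if_neg hne, mul_zero, mul_zero]
      · intro hn
        exact absurd (Finset.mem_Icc.2 ⟨hp1, hp2⟩) hn
    have r3 : ∑ q ∈ Finset.Icc 1 (nn t α), a q * (if q + 1 = p then (1 : ℝ) else 0)
        = a (p - 1) := by
      rw [Finset.sum_eq_single (p - 1)]
      · rw [if_pos (by omega), mul_one]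
      · intro q hq hne
        rw [if_neg (by omega), mul_zero]
      · intro hn
        rw [Finset.mem_Icc] at hn
        have : p - 1 = 0 := by omega
        rw [this, ha0, zero_mul]
    rw [r1, r2, r3] at hR
    linarith
  -- step 3
  have s3 : ∀ p ≤ nn t α, a p = 0 := by
    intro p hp
    apply le_antisymm
    · refine max_principle ha0.le (fun q h1 h2 => ?_) han.le p hp
      rcases s2 q h1 h2 with h | h
      · exact Or.inl h.le
      · exact Or.inr h.le
    · have := max_principle (n := nn t α) (a := fun q => - a q) (by simp [ha0])
        (fun q h1 h2 => ?_) (by simp [han]) p hp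
      · simpa using this
      · rcases s2 q h1 h2 with h | h
        · left; simp [h]
        · right; linarith
  refine coeff_zero hF c d fun I => ?_
  rw [h' I, Finset.sum_eq_zero, add_zero]
  intro p hp
  rw [Finset.mem_Icc] at hp
  rw [s3 p hp.2, zero_mul]

theorem togg_coeffs {t : ℕ} {α : ℕ → ℕ} {g : J t α → ℝ} (hg : g ∈ ToggSpan t α) :
    ∃ a : ℕ → ℝ, a 0 = 0 ∧ a (nn t α + 1) = 0 ∧
      ∀ I, g I = ∑ p ∈ Finset.Icc 1 (nn t α), a p * Tg t α (xel t α p) I := by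
  unfold ToggSpan at hg
  induction hg using Submodule.span_induction with
  | mem x hx =>
    obtain ⟨p, hp, rfl⟩ := hx
    have hp2 := p.2
    unfold Elem at hp
    refine ⟨fun q => if q = p then 1 else 0, if_neg (by omega), if_neg (by omega), fun I => ?_⟩
    rw [Finset.sum_eq_single (p : ℕ)]
    · simp [xel_self]
    · intro q _ hq; simp [hq]
    · intro hn; exact absurd (Finset.mem_Icc.2 ⟨hp, by omega⟩) hn
  | zero => exact ⟨0, rfl, rfl, by simp⟩
  | add x y _ _ hx hy =>
    obtain ⟨a, h1, h2, h3⟩ := hx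
    obtain ⟨b, h4, h5, h6⟩ := hy
    exact ⟨a + b, by simp [h1, h4], by simp [h2, h5], fun I => by
      simp [h3, h6, add_mul, Finset.sum_add_distrib]⟩
  | smul r x _ hx =>
    obtain ⟨a, h1, h2, h3⟩ := hx
    exact ⟨r • a, by simp [h1], by simp [h2], fun I => by
      simp [h3, Finset.mul_sum, mul_assoc]⟩

/-- Lemma `glc oic lemma`.
The order-ideal indicators `χ̂_{s_1},…,χ̂_{s_{t−1}}` of the shared elements are linearly
independent, and their span meets the order ideal toggleability space `I_T(F)` trivially. -/
theorem statement7 (t : ℕ) (α : ℕ → ℕ) (hF : IsFence t α) :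
    LinearIndependent ℝ (fun i : Fin (t - 1) => chiHat t α (sElx t α ((i : ℕ) + 1)))
    ∧ Submodule.span ℝ
        (Set.range (fun i : Fin (t - 1) => chiHat t α (sElx t α ((i : ℕ) + 1)))) ⊓ IT t α = ⊥ := by
  have hs : ∀ (c : Fin (t - 1) → ℝ) (I : J t α),
      (∑ i, c i • chiHat t α (sElx t α ((i : ℕ) + 1))) I
        = ∑ i, c i * X t α I (m α (i + 1)) := by
    intro c I
    rw [Finset.sum_apply]
    refine Finset.sum_congr rfl fun i _ => ?_
    have hi := i.2
    rw [Pi.smul_apply, smul_eq_mul, chiHat_s hF (by omega) (by omega)]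
  constructor
  · rw [Fintype.linearIndependent_iff]
    intro c hc
    refine coeff_zero hF c 0 fun I => ?_
    rw [← hs, hc]; rfl
  · rw [eq_bot_iff]
    rintro f ⟨hf1, _, hf2⟩
    rw [SetLike.mem_coe, Submodule.mem_span_range_iff_exists_fun] at hf1
    obtain ⟨c, rfl⟩ := hf1
    rw [ConstPlusTogg, SetLike.mem_coe, Submodule.mem_sup] at hf2
    obtain ⟨g, hg, k, hk, hgk⟩ := hf2
    rw [Submodule.mem_span_singleton] at hk
    obtain ⟨d, rfl⟩ := hk
    obtain ⟨a, h1, h2, h3⟩ := togg_coeffs hg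
    have hc := main_aux hF c d a h1 h2 fun I => by
      rw [← hs, ← hgk, ← h3]
      simp [add_comm]
    rw [Submodule.mem_bot]
    exact Finset.sum_eq_zero fun i _ => by rw [hc i, zero_smul]

end Fence
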